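/- Let A_Γ be the associative F₂-algebra presented by generators e₁,e₂,e₃,e₄ and relations e_ie_j = e_je_i (1 ≤ i < j ≤ 4), e_i² = 0 (1 ≤ i ≤ 4), e₁e₃ = 0 and e₂e₄ = 0. Let (b₁,b₂,b₃,b₄) and (b₁',b₂',b₃',b₄') be nonzero vectors in F₂⁴ and set α := b₁e₁ + b₂e₂ + b₃e₃ + b₄e₄ and α' := b₁'e₁ + b₂'e₂ + b₃'e₃ + b₄'e₄. If α·α' = 0 in A_Γ, then at least one of the following holds: (i) b₂ = b₄ = b₂' = b₄' = 0 (both α and α' lie in the span of {e₁,e₃}); (ii) b₁ = b₃ = b₁' = b₃' = 0 (both lie in the span of {e₂,e₄}); (iii) (b₁,b₂,b₃,b₄) = (b₁',b₂',b₃',b₄'), i.e. α = α'. -/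

import Mathlib

/-- The defining relations of the algebra `A_Γ` (generators `e₁,e₂,e₃,e₄` indexed by
`0,1,2,3`): `eᵢeⱼ = eⱼeᵢ` (`1 ≤ i < j ≤ 4`), `eᵢ² = 0`, `e₁e₃ = 0`, `e₂e₄ = 0`. -/
inductive AΓRel : FreeAlgebra (ZMod 2) (Fin 4) → FreeAlgebra (ZMod 2) (Fin 4) → Prop
  | comm (i j : Fin 4) (hij : i < j) :
      AΓRel (FreeAlgebra.ι (ZMod 2) i * FreeAlgebra.ι (ZMod 2) j)
        (FreeAlgebra.ι (ZMod 2) j * FreeAlgebra.ι (ZMod 2) i)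
  | sq (i : Fin 4) : AΓRel (FreeAlgebra.ι (ZMod 2) i * FreeAlgebra.ι (ZMod 2) i) 0
  | rel13 : AΓRel (FreeAlgebra.ι (ZMod 2) 0 * FreeAlgebra.ι (ZMod 2) 2) 0
  | rel24 : AΓRel (FreeAlgebra.ι (ZMod 2) 1 * FreeAlgebra.ι (ZMod 2) 3) 0

/-- The associative `𝔽₂`-algebra `A_Γ` presented by generators `e₁,…,e₄` (indexed by
`Fin 4`) and the relations `AΓRel`; it realizes the mod-2 cohomology ring of the
right-angled Artin group on the 4-cycle. -/
abbrev AΓ : Type := RingQuot AΓRel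

/-- The generator `e_{i+1}` of `A_Γ` (so `e 0 = e₁`, …, `e 3 = e₄`). -/
noncomputable def e (i : Fin 4) : AΓ :=
  RingQuot.mkAlgHom (ZMod 2) AΓRel (FreeAlgebra.ι (ZMod 2) i)

/-- The algebra homomorphism from `A_Γ` to a commutative algebra that sends `e₁, e₃` to multiples
of a square-zero element `x` and `e₂, e₄` to multiples of a square-zero element `y`. -/
noncomputable def liftSqZero {B : Type*} [CommRing B] [Algebra (ZMod 2) B] {x y : B}
    (hx : x * x = 0) (hy : y * y = 0) (c : Fin 4 → ZMod 2) : AΓ →ₐ[ZMod 2] B :=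
  RingQuot.liftAlgHom (ZMod 2)
    ⟨FreeAlgebra.lift (ZMod 2) (fun i => c i • ![x, y, x, y] i), by
      intro _ _ hr
      induction hr with
      | comm i j hij => simp only [map_mul, mul_comm]
      | sq i => fin_cases i <;> simp [hx, hy]
      | rel13 => simp [hx]
      | rel24 => simp [hy]⟩

theorem liftSqZero_e {B : Type*} [CommRing B] [Algebra (ZMod 2) B] {x y : B}
    (hx : x * x = 0) (hy : y * y = 0) (c : Fin 4 → ZMod 2) (i : Fin 4) :
    liftSqZero hx hy c (e i) = c i • ![x, y, x, y] i := by
  simp [liftSqZero, e]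

open DualNumber in
/-- The coefficient of `xy` in the image of a product of two degree-one classes
in `𝔽₂[x, y]/(x², y²)`. -/
theorem coeff_eq_zero_of_mul_eq_zero {b1 b2 b3 b4 b1' b2' b3' b4' : ZMod 2}
    (hmul : (b1 • e 0 + b2 • e 1 + b3 • e 2 + b4 • e 3) *
        (b1' • e 0 + b2' • e 1 + b3' • e 2 + b4' • e 3) = 0) (c : Fin 4 → ZMod 2) :
    (b1 * c 0 + b3 * c 2) * (b2' * c 1 + b4' * c 3) +
      (b2 * c 1 + b4 * c 3) * (b1' * c 0 + b3' * c 2) = 0 := by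
  have hx : (TrivSqZeroExt.inl ε * TrivSqZeroExt.inl ε : (ZMod 2)[ε][ε]) = 0 := by
    rw [← TrivSqZeroExt.inl_mul, DualNumber.eps_mul_eps, TrivSqZeroExt.inl_zero]
  have hy : (ε * ε : (ZMod 2)[ε][ε]) = 0 := DualNumber.eps_mul_eps
  have key := congrArg
    (fun z => (liftSqZero (B := (ZMod 2)[ε][ε]) hx hy c z).snd.snd) hmul
  simp [liftSqZero_e] at key
  linear_combination key

theorem supported_on_side_or_eq_of_cross_products : ∀ b b' : Fin 4 → ZMod 2, b ≠ 0 → b' ≠ 0 →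
    b 0 * b' 1 + b 1 * b' 0 = 0 → b 0 * b' 3 + b 3 * b' 0 = 0 →
    b 2 * b' 1 + b 1 * b' 2 = 0 → b 2 * b' 3 + b 3 * b' 2 = 0 →
    (b 1 = 0 ∧ b 3 = 0 ∧ b' 1 = 0 ∧ b' 3 = 0) ∨ (b 0 = 0 ∧ b 2 = 0 ∧ b' 0 = 0 ∧ b' 2 = 0) ∨
      (b' 0 = b 0 ∧ b' 1 = b 1 ∧ b' 2 = b 2 ∧ b' 3 = b 3) := by
  decide +kernel

/-- in the algebra `A_Γ`, if `α = b₁e₁ + ⋯ + b₄e₄` and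
`α' = b₁'e₁ + ⋯ + b₄'e₄` are given by nonzero coefficient vectors and `α·α' = 0`, then
either both lie in the span of `{e₁,e₃}`, or both lie in the span of `{e₂,e₄}`,
or `α = α'`. -/
theorem stmt_12 (b1 b2 b3 b4 b1' b2' b3' b4' : ZMod 2)
    (h : ¬(b1 = 0 ∧ b2 = 0 ∧ b3 = 0 ∧ b4 = 0))
    (h' : ¬(b1' = 0 ∧ b2' = 0 ∧ b3' = 0 ∧ b4' = 0))
    (hmul : (b1 • e 0 + b2 • e 1 + b3 • e 2 + b4 • e 3) *
        (b1' • e 0 + b2' • e 1 + b3' • e 2 + b4' • e 3) = 0) :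
    (b2 = 0 ∧ b4 = 0 ∧ b2' = 0 ∧ b4' = 0) ∨
    (b1 = 0 ∧ b3 = 0 ∧ b1' = 0 ∧ b3' = 0) ∨
    (b1' = b1 ∧ b2' = b2 ∧ b3' = b3 ∧ b4' = b4) := by
  refine supported_on_side_or_eq_of_cross_products ![b1, b2, b3, b4] ![b1', b2', b3', b4']
    (by simpa using h) (by simpa using h') ?_ ?_ ?_ ?_
  · simpa using coeff_eq_zero_of_mul_eq_zero hmul ![1, 1, 0, 0]
  · simpa using coeff_eq_zero_of_mul_eq_zero hmul ![1, 0, 0, 1]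
  · simpa using coeff_eq_zero_of_mul_eq_zero hmul ![0, 1, 1, 0]
  · simpa using coeff_eq_zero_of_mul_eq_zero hmul ![0, 0, 1, 1]
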